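/- Let k be a field of characteristic 0, let δ ≥ 1, and let λ₁, …, λ_δ ∈ k. Let F(X,Z) = ∏_{i=1}^{δ} ( −X^{60} + (684−λ_i)X^{55}Z⁵ − (55λ_i+157434)X^{50}Z^{10} − (1205λ_i−12527460)X^{45}Z^{15} − (13090λ_i+77460495)X^{40}Z^{20} + (130689144−69585λ_i)X^{35}Z^{25} + (33211924−134761λ_i)X^{30}Z^{30} + (69585λ_i−130689144)X^{25}Z^{35} − (13090λ_i+77460495)X^{20}Z^{40} − (12527460−1205λ_i)X^{15}Z^{45} − (157434+55λ_i)X^{10}Z^{50} + (λ_i−684)X⁵Z^{55} − Z^{60} ), a binary form of degree d = 60δ (the binary form of the generic superelliptic curve y^n = f(x) with reduced automorphism group A₅). Then for each i ∈ {4, 8, 16, 28}, the invariant (J_i, J_i)^{i} = 0, where J_i := (F,F)^{d−i/2}. -/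

import Mathlib

open MvPolynomial Finset

/-- The `r`-th transvection (transvectant) of two binary forms `f, g ∈ k[X,Z]` of
degrees `n` and `m` respectively:
`(f,g)^r = ((m−r)!(n−r)!/(n!·m!)) · Σ_{j=0}^{r} (−1)^j C(r,j) ·
  (∂^r f/∂X^{r−j}∂Z^{j}) · (∂^r g/∂X^{j}∂Z^{r−j})`.
Binary forms are represented as polynomials in `MvPolynomial (Fin 2) k`, with `X` the
variable of index `0` and `Z` the variable of index `1`. -/
noncomputable def transvect {k : Type*} [Field k] (n m r : ℕ)
    (f g : MvPolynomial (Fin 2) k) : MvPolynomial (Fin 2) k :=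
  let DX : MvPolynomial (Fin 2) k → MvPolynomial (Fin 2) k := fun h => pderiv (0 : Fin 2) h
  let DZ : MvPolynomial (Fin 2) k → MvPolynomial (Fin 2) k := fun h => pderiv (1 : Fin 2) h
  C ((((m - r).factorial * (n - r).factorial : ℕ) : k) /
      ((n.factorial * m.factorial : ℕ) : k)) *
    ∑ j ∈ range (r + 1),
      C ((-1 : k) ^ j * (r.choose j : k)) * (DX^[r - j] (DZ^[j] f)) * (DZ^[r - j] (DX^[j] g))

section A5helpers
open scoped TensorProduct

variable {K : Type*} [Field K]

/-- The linear substitution `X ↦ aX + bZ`, `Z ↦ cX + dZ`. -/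
noncomputable def linSub (a b c d : K) :
    MvPolynomial (Fin 2) K →ₐ[K] MvPolynomial (Fin 2) K :=
  aeval ![C a * X 0 + C b * X 1, C c * X 0 + C d * X 1]

lemma linSub_X0 (a b c d : K) : linSub a b c d (X 0) = C a * X 0 + C b * X 1 := by
  simp [linSub]

lemma linSub_X1 (a b c d : K) : linSub a b c d (X 1) = C c * X 0 + C d * X 1 := by
  simp [linSub]

lemma linSub_C (a b c d e : K) : linSub a b c d (C e) = C e := by
  simp [linSub]

lemma pderiv0_linSub (a b c d : K) (f : MvPolynomial (Fin 2) K) :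
    pderiv 0 (linSub a b c d f) =
      C a * linSub a b c d (pderiv 0 f) + C c * linSub a b c d (pderiv 1 f) := by
  induction f using MvPolynomial.induction_on with
  | C e => simp
  | add f g hf hg => simp only [map_add, hf, hg]; ring
  | mul_X f i hf =>
    have h01 : pderiv (0 : Fin 2) (X 1 : MvPolynomial (Fin 2) K) = 0 :=
      pderiv_X_of_ne (by decide)
    have h10 : pderiv (1 : Fin 2) (X 0 : MvPolynomial (Fin 2) K) = 0 :=
      pderiv_X_of_ne (by decide)
    fin_cases i <;>
    simp [hf, linSub_X0, linSub_X1, h01, h10] <;> ring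

lemma pderiv1_linSub (a b c d : K) (f : MvPolynomial (Fin 2) K) :
    pderiv 1 (linSub a b c d f) =
      C b * linSub a b c d (pderiv 0 f) + C d * linSub a b c d (pderiv 1 f) := by
  induction f using MvPolynomial.induction_on with
  | C e => simp
  | add f g hf hg => simp only [map_add, hf, hg]; ring
  | mul_X f i hf =>
    have h01 : pderiv (0 : Fin 2) (X 1 : MvPolynomial (Fin 2) K) = 0 :=
      pderiv_X_of_ne (by decide)
    have h10 : pderiv (1 : Fin 2) (X 0 : MvPolynomial (Fin 2) K) = 0 :=
      pderiv_X_of_ne (by decide)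
    fin_cases i <;>
    simp [hf, linSub_X0, linSub_X1, h01, h10] <;> ring

lemma pderiv_comm' (f : MvPolynomial (Fin 2) K) :
    pderiv 0 (pderiv 1 f) = pderiv 1 (pderiv 0 f) := by
  ext m
  simp only [coeff_pderiv]
  rw [add_right_comm]
  simp
  ring

/-- Partial derivative as a linear endomorphism. -/
noncomputable def dL (K : Type*) [Field K] (i : Fin 2) :
    Module.End K (MvPolynomial (Fin 2) K) := (pderiv i).toLinearMap

lemma dL_apply (i : Fin 2) (f : MvPolynomial (Fin 2) K) : dL K i f = pderiv i f := rfl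

lemma dL_pow (i : Fin 2) (n : ℕ) (f : MvPolynomial (Fin 2) K) :
    (dL K i ^ n) f = (fun h => pderiv i h)^[n] f := by
  rw [Module.End.pow_apply]; rfl

lemma dL_commute : Commute (dL K 0) (dL K 1) := by
  refine LinearMap.ext fun f => ?_
  exact pderiv_comm' f

/-- Cayley's omega process on the tensor square. -/
noncomputable def omegaA (K : Type*) [Field K] :
    Module.End K (MvPolynomial (Fin 2) K ⊗[K] MvPolynomial (Fin 2) K) :=
  TensorProduct.map (dL K 0) (dL K 1)

/-- The second half of the omega process. -/
noncomputable def omegaB (K : Type*) [Field K] :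
    Module.End K (MvPolynomial (Fin 2) K ⊗[K] MvPolynomial (Fin 2) K) :=
  TensorProduct.map ((-1 : K) • dL K 1) (dL K 0)

lemma omega_commute : Commute (omegaA K) (omegaB K) := by
  unfold omegaA omegaB Commute SemiconjBy
  rw [← TensorProduct.map_mul, ← TensorProduct.map_mul, mul_smul_comm, smul_mul_assoc,
    dL_commute.eq]

lemma transvect_eq (n m r : ℕ) (f g : MvPolynomial (Fin 2) K) :
    transvect n m r f g =
      C ((((m - r).factorial * (n - r).factorial : ℕ) : K) /
        ((n.factorial * m.factorial : ℕ) : K)) *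
      LinearMap.mul' K (MvPolynomial (Fin 2) K) (((omegaA K + omegaB K) ^ r) (f ⊗ₜ g)) := by
  unfold transvect
  dsimp only
  congr 1
  have hc : Commute (omegaB K) (omegaA K) := (omega_commute (K := K)).symm
  rw [add_comm (omegaA K), hc.add_pow, LinearMap.sum_apply, map_sum]
  refine Finset.sum_congr rfl fun j _ => ?_
  rw [(hc.pow_pow j (r - j)).eq, ← (Nat.cast_commute (r.choose j) _).eq]
  have h1 : ∀ e : ℕ, (omegaA K) ^ e = TensorProduct.map (dL K 0 ^ e) (dL K 1 ^ e) := fun e => by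
    rw [omegaA, TensorProduct.map_pow]
  have h2 : ∀ e : ℕ, (omegaB K) ^ e =
      TensorProduct.map ((-1 : K) ^ e • dL K 1 ^ e) (dL K 0 ^ e) := fun e => by
    rw [omegaB, TensorProduct.map_pow, smul_pow]
  rw [h1, h2]
  simp only [Module.End.mul_apply, Module.End.natCast_apply, TensorProduct.map_tmul,
    LinearMap.smul_apply, map_smul, map_nsmul, dL_pow, LinearMap.mul'_apply,
    ← TensorProduct.smul_tmul']
  rw [C_mul, mul_assoc, mul_assoc, C_mul', C_mul', Nat.cast_smul_eq_nsmul]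

lemma omega_linSub (a b c d : K) :
    (omegaA K + omegaB K) ∘ₗ
        TensorProduct.map (linSub a b c d).toLinearMap (linSub a b c d).toLinearMap =
      (a * d - b * c) • (TensorProduct.map (linSub a b c d).toLinearMap
        (linSub a b c d).toLinearMap ∘ₗ (omegaA K + omegaB K)) := by
  apply TensorProduct.ext'
  intro f g
  simp only [omegaA, omegaB, LinearMap.comp_apply, LinearMap.add_apply, TensorProduct.map_tmul,
    LinearMap.smul_apply, map_add, map_smul, dL_apply, AlgHom.toLinearMap_apply, pderiv0_linSub,
    pderiv1_linSub, C_mul']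
  simp only [TensorProduct.add_tmul, TensorProduct.tmul_add, ← TensorProduct.smul_tmul',
    TensorProduct.tmul_smul]
  module

lemma omega_pow_linSub (a b c d : K) (r : ℕ)
    (t : MvPolynomial (Fin 2) K ⊗[K] MvPolynomial (Fin 2) K) :
    ((omegaA K + omegaB K) ^ r)
        (TensorProduct.map (linSub a b c d).toLinearMap (linSub a b c d).toLinearMap t) =
      (a * d - b * c) ^ r • (TensorProduct.map (linSub a b c d).toLinearMap
        (linSub a b c d).toLinearMap (((omegaA K + omegaB K) ^ r) t)) := by
  induction r generalizing t with
  | zero => simp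
  | succ r ih =>
    have h := LinearMap.congr_fun (omega_linSub a b c d) t
    rw [LinearMap.comp_apply] at h
    rw [pow_succ, Module.End.mul_apply, h, LinearMap.smul_apply, map_smul, LinearMap.comp_apply, ih,
      Module.End.mul_apply, smul_smul, pow_succ']

/-- Equivariance of transvectants. -/
lemma transvect_linSub (n m r : ℕ) (a b c d : K) (f g : MvPolynomial (Fin 2) K) :
    transvect n m r (linSub a b c d f) (linSub a b c d g) =
      C ((a * d - b * c) ^ r) * linSub a b c d (transvect n m r f g) := by
  have h := omega_pow_linSub a b c d r (f ⊗ₜ g)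
  rw [TensorProduct.map_tmul] at h
  simp only [AlgHom.toLinearMap_apply] at h
  have h3 : ∀ t : MvPolynomial (Fin 2) K ⊗[K] MvPolynomial (Fin 2) K,
      LinearMap.mul' K _ (TensorProduct.map (linSub a b c d).toLinearMap
        (linSub a b c d).toLinearMap t) = linSub a b c d (LinearMap.mul' K _ t) := by
    intro t
    induction t with
    | zero => simp
    | add x y hx hy => simp only [map_add, hx, hy]
    | tmul x y => simp
  rw [transvect_eq, transvect_eq, h, map_smul, h3, map_mul, linSub_C, ← C_mul']
  ring

lemma transvect_C_mul (n m r : ℕ) (a b : K) (f g : MvPolynomial (Fin 2) K) :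
    transvect n m r (C a * f) (C b * g) = C (a * b) * transvect n m r f g := by
  rw [transvect_eq, transvect_eq, C_mul' (a := a), C_mul' (a := b), TensorProduct.smul_tmul_smul, map_smul,
    map_smul, ← C_mul']
  ring

lemma transvect_map {L : Type*} [Field L] (s : K →+* L) (n m r : ℕ)
    (f g : MvPolynomial (Fin 2) K) :
    MvPolynomial.map s (transvect n m r f g) =
      transvect n m r (MvPolynomial.map s f) (MvPolynomial.map s g) := by
  have hit : ∀ (i : Fin 2) (e : ℕ) (h : MvPolynomial (Fin 2) K),
      MvPolynomial.map s ((fun h => pderiv i h)^[e] h) =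
        (fun h => pderiv i h)^[e] (MvPolynomial.map s h) := by
    intro i e
    induction e with
    | zero => intro h; rfl
    | succ e ih => intro h; rw [Function.iterate_succ_apply, Function.iterate_succ_apply, ih,
        pderiv_map]
  simp only [transvect, map_mul, map_sum, hit, map_C, map_div₀, map_natCast, map_pow, map_neg,
    map_one]

/-- Weighted homogeneity of transvectants. -/
lemma transvect_weighted {M : Type*} [AddCommGroup M] (w : Fin 2 → M) (n m r : ℕ)
    (f g : MvPolynomial (Fin 2) K) (e e' t : M) (hf : IsWeightedHomogeneous w f e)
    (hg : IsWeightedHomogeneous w g e') (ht : t = e + e' - r • (w 0 + w 1)) :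
    IsWeightedHomogeneous w (transvect n m r f g) t := by
  have hit : ∀ (i : Fin 2) (s : ℕ) (h : MvPolynomial (Fin 2) K) (e : M),
      IsWeightedHomogeneous w h e →
      IsWeightedHomogeneous w ((fun h => pderiv i h)^[s] h) (e - s • w i) := by
    intro i s
    induction s with
    | zero => intro h e he; simpa using he
    | succ s ih =>
      intro h e he
      rw [Function.iterate_succ_apply]
      have := ih (pderiv i h) (e - w i) (he.pderiv (by abel))
      convert this using 1
      rw [succ_nsmul]; abel
  unfold transvect
  refine IsWeightedHomogeneous.C_mul ?_ _
  refine IsWeightedHomogeneous.sum _ _ _ fun j hj => ?_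
  have hj' : j ≤ r := by simpa [Nat.lt_succ_iff] using hj
  have h1 := hit 0 (r - j) _ _ (hit 1 j f e hf)
  have h2 := hit 1 (r - j) _ _ (hit 0 j g e' hg)
  have h3 := (IsWeightedHomogeneous.C_mul h1 ((-1 : K) ^ j * (r.choose j : K))).mul h2
  convert h3 using 1
  rw [ht]
  obtain ⟨s, rfl⟩ := Nat.exists_eq_add_of_le hj'
  simp only [Nat.add_sub_cancel_left, add_smul, smul_add]
  abel

end A5helpers

section A5forms

/-- Klein's icosahedral form of degree 20. -/
def kleinH {R : Type*} [CommRing R] (x z : R) : R :=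
  -(x ^ 20 + z ^ 20) + 228 * (x ^ 15 * z ^ 5 - x ^ 5 * z ^ 15) - 494 * (x ^ 10 * z ^ 10)

/-- Klein's icosahedral form of degree 12. -/
def kleinF {R : Type*} [CommRing R] (x z : R) : R :=
  x * z * (x ^ 10 + 11 * (x ^ 5 * z ^ 5) - z ^ 10)

lemma golden_pow {R : Type*} [CommRing R] (p : R) (hp : p ^ 2 = p + 1) (n : ℕ) :
    p ^ (n + 1) = (Nat.fib (n + 1) : R) * p + (Nat.fib n : R) := by
  induction n with
  | zero => simp
  | succ n ih =>
    rw [pow_succ, ih, Nat.fib_add_two]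
    push_cast
    linear_combination (Nat.fib (n + 1) : R) * hp

lemma golden_sq {R : Type*} [CommRing R] (p : R) (hp : p ^ 2 = p + 1) :
    (p ^ 2 + 1) ^ 2 = 5 * p ^ 2 := by
  linear_combination (p ^ 2 + p - 1) * hp


lemma golden_AB {R : Type*} [CommRing R] (p x z : R) (hp : p ^ 2 = p + 1) :
    (-p * x + z) * (x + p * z) = p * (z ^ 2 - x * z - x ^ 2) := by
  linear_combination (-x*z)*hp

lemma golden_N {R : Type*} [CommRing R] (p x z : R) (hp : p ^ 2 = p + 1) :
    (-p * x + z) ^ 10 - (x + p * z) ^ 10 = p ^ 5 *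
      ((11)*x^10*z^0 + (-70)*x^9*z^1 + (180)*x^8*z^2 + (-360)*x^7*z^3 + (210)*x^6*z^4 + (-504)*x^5*z^5 + (-210)*x^4*z^6 + (-360)*x^3*z^7 + (-180)*x^2*z^8 + (-70)*x^1*z^9 + (-11)*x^0*z^10) := by
  have w2 : p ^ 2 = 1 * p + 1 := by rw [hp, one_mul]
  have w3 : p ^ 3 = 2 * p + 1 := by
    have := golden_pow p hp 2
    norm_num [Nat.fib_add_two] at this
    exact this
  have w4 : p ^ 4 = 3 * p + 2 := by
    have := golden_pow p hp 3
    norm_num [Nat.fib_add_two] at this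
    exact this
  have w5 : p ^ 5 = 5 * p + 3 := by
    have := golden_pow p hp 4
    norm_num [Nat.fib_add_two] at this
    exact this
  have hU : (-p * x + z) ^ 5 = ((-3)*x^5*z^0 + (10)*x^4*z^1 + (-10)*x^3*z^2 + (10)*x^2*z^3 + (1)*x^0*z^5) + ((-5)*x^5*z^0 + (15)*x^4*z^1 + (-20)*x^3*z^2 + (10)*x^2*z^3 + (-5)*x^1*z^4) * p := by
    linear_combination (10)*x^2*z^3*w2 + (-10)*x^3*z^2*w3 + (5)*x^4*z^1*w4 + (-1)*x^5*z^0*w5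
  have hV : (x + p * z) ^ 5 = ((1)*x^5*z^0 + (10)*x^3*z^2 + (10)*x^2*z^3 + (10)*x^1*z^4 + (3)*x^0*z^5) + ((5)*x^4*z^1 + (10)*x^3*z^2 + (20)*x^2*z^3 + (15)*x^1*z^4 + (5)*x^0*z^5) * p := by
    linear_combination (10)*x^3*z^2*w2 + (10)*x^2*z^3*w3 + (5)*x^1*z^4*w4 + (1)*x^0*z^5*w5
  have e1 : (-p * x + z) ^ 10 = ((-p * x + z) ^ 5) ^ 2 := by ring
  have e2 : (x + p * z) ^ 10 = ((x + p * z) ^ 5) ^ 2 := by ring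
  rw [e1, e2, hU, hV, w5]
  linear_combination (((-5)*x^5*z^0 + (15)*x^4*z^1 + (-20)*x^3*z^2 + (10)*x^2*z^3 + (-5)*x^1*z^4) ^ 2 - ((5)*x^4*z^1 + (10)*x^3*z^2 + (20)*x^2*z^3 + (15)*x^1*z^4 + (5)*x^0*z^5) ^ 2) * hp

lemma kleinH_golden {R : Type*} [CommRing R] (p x z : R) (hp : p ^ 2 = p + 1) :
    kleinH (-p * x + z) (x + p * z) = (p ^ 2 + 1) ^ 10 * kleinH x z := by
  have h1 := golden_AB p x z hp
  have h2 := golden_N p x z hp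
  have h3 := golden_sq p hp
  have e1 : kleinH (-p * x + z) (x + p * z) =
      -((-p * x + z) ^ 10 - (x + p * z) ^ 10) ^ 2
      + 228 * ((-p * x + z) * (x + p * z)) ^ 5 * ((-p * x + z) ^ 10 - (x + p * z) ^ 10)
      - 496 * (((-p * x + z) * (x + p * z)) ^ 5) ^ 2 := by
    unfold kleinH
    generalize -p * x + z = A
    generalize x + p * z = B
    ring
  have e2 : (p ^ 2 + 1) ^ 10 = 3125 * p ^ 10 := by
    calc (p ^ 2 + 1) ^ 10 = ((p ^ 2 + 1) ^ 2) ^ 5 := by ring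
      _ = 3125 * p ^ 10 := by rw [h3]; ring
  rw [e1, e2, h1, h2]
  unfold kleinH
  ring

lemma kleinF_golden {R : Type*} [CommRing R] (p x z : R) (hp : p ^ 2 = p + 1) :
    kleinF (-p * x + z) (x + p * z) = (p ^ 2 + 1) ^ 6 * kleinF x z := by
  have h1 := golden_AB p x z hp
  have h2 := golden_N p x z hp
  have h3 := golden_sq p hp
  have e1 : kleinF (-p * x + z) (x + p * z) =
      ((-p * x + z) * (x + p * z)) * (((-p * x + z) ^ 10 - (x + p * z) ^ 10)
      + 11 * ((-p * x + z) * (x + p * z)) ^ 5) := by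
    unfold kleinF
    generalize -p * x + z = A
    generalize x + p * z = B
    ring
  have e2 : (p ^ 2 + 1) ^ 6 = 125 * p ^ 6 := by
    calc (p ^ 2 + 1) ^ 6 = ((p ^ 2 + 1) ^ 2) ^ 3 := by ring
      _ = 125 * p ^ 6 := by rw [h3]; ring
  rw [e1, e2, h1, h2]
  unfold kleinF
  ring


lemma golden_lin4 {K : Type*} [Field K] [CharZero K] (p a : K) (hp : p ^ 2 = p + 1)
    (h : ∀ x z : K, a * (-p * x + z) ^ 2 * (x + p * z) ^ 2 =
      (p ^ 2 + 1) ^ 2 * (a * x ^ 2 * z ^ 2)) :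
    a = 0 := by
  have hD : (p ^ 2 + 1) ^ 2 = 5 * p ^ 2 := by
    calc (p ^ 2 + 1) ^ 2 = ((p ^ 2 + 1) ^ 2) ^ 1 := by ring
      _ = 5 * p ^ 2 := by rw [golden_sq p hp]; ring
  have hp0 : p ≠ 0 := by
    rintro rfl
    norm_num at hp
  have h0 := h 1 0
  simpa [hp0] using h0


lemma golden_lin8 {K : Type*} [Field K] [CharZero K] (p a : K) (hp : p ^ 2 = p + 1)
    (h : ∀ x z : K, a * (-p * x + z) ^ 4 * (x + p * z) ^ 4 =
      (p ^ 2 + 1) ^ 4 * (a * x ^ 4 * z ^ 4)) :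
    a = 0 := by
  have hD : (p ^ 2 + 1) ^ 4 = 25 * p ^ 4 := by
    calc (p ^ 2 + 1) ^ 4 = ((p ^ 2 + 1) ^ 2) ^ 2 := by ring
      _ = 25 * p ^ 4 := by rw [golden_sq p hp]; ring
  have hp0 : p ≠ 0 := by
    rintro rfl
    norm_num at hp
  have h0 := h 1 0
  simpa [hp0] using h0


lemma golden_lin16 {K : Type*} [Field K] [CharZero K] (p a b c : K) (hp : p ^ 2 = p + 1)
    (h : ∀ x z : K, a * (-p * x + z) ^ 3 * (x + p * z) ^ 13 + b * (-p * x + z) ^ 8 * (x + p * z) ^ 8 + c * (-p * x + z) ^ 13 * (x + p * z) ^ 3 =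
      (p ^ 2 + 1) ^ 8 * (a * x ^ 3 * z ^ 13 + b * x ^ 8 * z ^ 8 + c * x ^ 13 * z ^ 3)) :
    a = 0 ∧ b = 0 ∧ c = 0 := by
  have hD : (p ^ 2 + 1) ^ 8 = 625 * p ^ 8 := by
    calc (p ^ 2 + 1) ^ 8 = ((p ^ 2 + 1) ^ 2) ^ 4 := by ring
      _ = 625 * p ^ 8 := by rw [golden_sq p hp]; ring
  have w3 : p ^ 3 = 2 * p + 1 := by
    have := golden_pow p hp 2
    norm_num [Nat.fib_add_two] at this
    exact this
  have w8 : p ^ 8 = 21 * p + 13 := by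
    have := golden_pow p hp 7
    norm_num [Nat.fib_add_two] at this
    exact this
  have w9 : p ^ 9 = 34 * p + 21 := by
    have := golden_pow p hp 8
    norm_num [Nat.fib_add_two] at this
    exact this
  have w13 : p ^ 13 = 233 * p + 144 := by
    have := golden_pow p hp 12
    norm_num [Nat.fib_add_two] at this
    exact this
  have w24 : p ^ 24 = 46368 * p + 28657 := by
    have := golden_pow p hp 23
    norm_num [Nat.fib_add_two] at this
    exact this
  have w39 : p ^ 39 = 63245986 * p + 39088169 := by
    have := golden_pow p hp 38
    norm_num [Nat.fib_add_two] at this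
    exact this
  have e0 : ((-1) + (-2) * p) * a + ((13) + (21) * p) * b + ((-144) + (-233) * p) * c = 0 := by
    have h0 := h 1 0
    rw [show -p * 1 + 0 = -p from by ring, show 1 + p * 0 = 1 from by ring, hD] at h0
    linear_combination h0 - (-1) * a * w3 - (1) * b * w8 - (-1) * c * w13
  have e1 : ((144) + (233) * p) * a + ((13) + (21) * p) * b + ((1) + (2) * p) * c = 0 := by
    have h0 := h 0 1
    rw [show -p * 0 + 1 = 1 from by ring, show 0 + p * 1 = p from by ring, hD] at h0
    linear_combination h0 - (1) * a * w13 - (1) * b * w8 - (1) * c * w3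
  have e2 : ((-56998794) + (-92225986) * p) * a + ((-17881968) + (-28933632) * p) * b + ((-17910646) + (-28980034) * p) * c = 0 := by
    have h0 := h p p
    rw [show -p * p + p = -1 from by linear_combination -hp, show p + p * p = p ^ 3 from by linear_combination (-p)*hp, hD] at h0
    linear_combination h0 - (-1) * a * w39 - (-625) * a * w24 - (1) * b * w24 - (-625) * b * w24 - (-1) * c * w9 - (-625) * c * w24
  have r0 : a = 0 := by
    linear_combination ((9397/2750) + (-264/125) * p) * e0 + ((1211/2750) + (-372/1375) * p) * e1 + ((3001/220) + (-11592/1375) * p) * e2 - ((1069083548844/1375) * a + (335398593348/1375) * b + (335937230016/1375) * c) * hp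
  have r1 : b = 0 := by
    linear_combination ((-967/250) + (299/125) * p) * e0 + ((-1141/250) + (352/125) * p) * e1 + ((-3001/20) + (11592/125) * p) * e2 - ((-1069083548294/125) * a + (-335398648473/125) * b + (-335936623091/125) * c) * hp
  have r2 : c = 0 := by
    linear_combination ((-1037/2750) + (29/125) * p) * e0 + ((-9571/2750) + (2957/1375) * p) * e1 + ((-3001/220) + (11592/1375) * p) * e2 - ((-1069082941369/1375) * a + (-335398593348/1375) * b + (-335936622541/1375) * c) * hp
  exact ⟨r0, r1, r2⟩


lemma golden_lin28 {K : Type*} [Field K] [CharZero K] (p a b c d e : K) (hp : p ^ 2 = p + 1)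
    (h : ∀ x z : K, a * (-p * x + z) ^ 4 * (x + p * z) ^ 24 + b * (-p * x + z) ^ 9 * (x + p * z) ^ 19 + c * (-p * x + z) ^ 14 * (x + p * z) ^ 14 + d * (-p * x + z) ^ 19 * (x + p * z) ^ 9 + e * (-p * x + z) ^ 24 * (x + p * z) ^ 4 =
      (p ^ 2 + 1) ^ 14 * (a * x ^ 4 * z ^ 24 + b * x ^ 9 * z ^ 19 + c * x ^ 14 * z ^ 14 + d * x ^ 19 * z ^ 9 + e * x ^ 24 * z ^ 4)) :
    a = 0 ∧ b = 0 ∧ c = 0 ∧ d = 0 ∧ e = 0 := by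
  have hD : (p ^ 2 + 1) ^ 14 = 78125 * p ^ 14 := by
    calc (p ^ 2 + 1) ^ 14 = ((p ^ 2 + 1) ^ 2) ^ 7 := by ring
      _ = 78125 * p ^ 14 := by rw [golden_sq p hp]; ring
  have w4 : p ^ 4 = 3 * p + 2 := by
    have := golden_pow p hp 3
    norm_num [Nat.fib_add_two] at this
    exact this
  have w9 : p ^ 9 = 34 * p + 21 := by
    have := golden_pow p hp 8
    norm_num [Nat.fib_add_two] at this
    exact this
  have w12 : p ^ 12 = 144 * p + 89 := by
    have := golden_pow p hp 11
    norm_num [Nat.fib_add_two] at this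
    exact this
  have w14 : p ^ 14 = 377 * p + 233 := by
    have := golden_pow p hp 13
    norm_num [Nat.fib_add_two] at this
    exact this
  have w19 : p ^ 19 = 4181 * p + 2584 := by
    have := golden_pow p hp 18
    norm_num [Nat.fib_add_two] at this
    exact this
  have w20 : p ^ 20 = 6765 * p + 4181 := by
    have := golden_pow p hp 19
    norm_num [Nat.fib_add_two] at this
    exact this
  have w24 : p ^ 24 = 46368 * p + 28657 := by
    have := golden_pow p hp 23
    norm_num [Nat.fib_add_two] at this
    exact this
  have w27 : p ^ 27 = 196418 * p + 121393 := by
    have := golden_pow p hp 26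
    norm_num [Nat.fib_add_two] at this
    exact this
  have w42 : p ^ 42 = 267914296 * p + 165580141 := by
    have := golden_pow p hp 41
    norm_num [Nat.fib_add_two] at this
    exact this
  have w45 : p ^ 45 = 1134903170 * p + 701408733 := by
    have := golden_pow p hp 44
    norm_num [Nat.fib_add_two] at this
    exact this
  have w57 : p ^ 57 = 365435296162 * p + 225851433717 := by
    have := golden_pow p hp 56
    norm_num [Nat.fib_add_two] at this
    exact this
  have w70 : p ^ 70 = 190392490709135 * p + 117669030460994 := by
    have := golden_pow p hp 69
    norm_num [Nat.fib_add_two] at this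
    exact this
  have w72 : p ^ 72 = 498454011879264 * p + 308061521170129 := by
    have := golden_pow p hp 71
    norm_num [Nat.fib_add_two] at this
    exact this
  have w95 : p ^ 95 = 31940434634990099905 * p + 19740274219868223167 := by
    have := golden_pow p hp 94
    norm_num [Nat.fib_add_two] at this
    exact this
  have w120 : p ^ 120 = 5358359254990966640871840 * p + 3311648143516982017180081 := by
    have := golden_pow p hp 119
    norm_num [Nat.fib_add_two] at this
    exact this
  have e0 : ((2) + (3) * p) * a + ((-21) + (-34) * p) * b + ((233) + (377) * p) * c + ((-2584) + (-4181) * p) * d + ((28657) + (46368) * p) * e = 0 := by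
    have h0 := h 1 0
    rw [show -p * 1 + 0 = -p from by ring, show 1 + p * 0 = 1 from by ring, hD] at h0
    linear_combination h0 - (1) * a * w4 - (-1) * b * w9 - (1) * c * w14 - (-1) * d * w19 - (1) * e * w24
  have e1 : ((28657) + (46368) * p) * a + ((2584) + (4181) * p) * b + ((233) + (377) * p) * c + ((21) + (34) * p) * d + ((2) + (3) * p) * e = 0 := by
    have h0 := h 0 1
    rw [show -p * 0 + 1 = 1 from by ring, show 0 + p * 1 = p from by ring, hD] at h0
    linear_combination h0 - (1) * a * w24 - (1) * b * w19 - (1) * c * w14 - (1) * d * w9 - (1) * e * w4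
  have e2 : ((295125572654504) + (477523207504264) * p) * a + ((-13161799949342) + (-21296239671162) * p) * b + ((-12935782935484) + (-20930536460704) * p) * c + ((-12935948637018) + (-20930804571418) * p) * d + ((-12935948515536) + (-20930804374856) * p) * e = 0 := by
    have h0 := h p p
    rw [show -p * p + p = -1 from by linear_combination -hp, show p + p * p = p ^ 3 from by linear_combination (-p)*hp, hD] at h0
    linear_combination h0 - (1) * a * w72 - (-78125) * a * w42 - (-1) * b * w57 - (-78125) * b * w42 - (1) * c * w42 - (-78125) * c * w42 - (-1) * d * w27 - (-78125) * d * w42 - (1) * e * w12 - (-78125) * e * w42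
  have e3 : ((-12935948515536) + (-20930804374856) * p) * a + ((12935948637018) + (20930804571418) * p) * b + ((-12935782935484) + (-20930536460704) * p) * c + ((13161799949342) + (21296239671162) * p) * d + ((295125572654504) + (477523207504264) * p) * e = 0 := by
    have h0 := h p (-p)
    rw [show -p * p + -p = -p ^ 3 from by linear_combination p*hp, show p + p * -p = -1 from by linear_combination -hp, hD] at h0
    linear_combination h0 - (1) * a * w12 - (-78125) * a * w42 - (1) * b * w27 - (78125) * b * w42 - (1) * c * w42 - (-78125) * c * w42 - (1) * d * w57 - (78125) * d * w42 - (1) * e * w72 - (-78125) * e * w42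
  have e4 : ((-150919503462317073662819919) + (-244192886167286460559128160) * p) * a + ((-4819703747408094371776833) + (-7798444479011534609900095) * p) * b + ((-150616358872403289539006) + (-243702387917300309290865) * p) * c + ((-4706761218439058591267) + (-7615699628364265096830) * p) * d + ((-147086288076242495819) + (-237990613386418743235) * p) * e = 0 := by
    have h0 := h (p ^ 2) (2 * p ^ 2)
    rw [show -p * p ^ 2 + 2 * p ^ 2 = 1 from by linear_combination (1 - p)*hp, show p ^ 2 + p * (2 * p ^ 2) = p ^ 5 from by linear_combination (-p^3-p^2)*hp, hD] at h0
    linear_combination h0 - (1) * a * w120 - (-1310720000000) * a * w70 - (1) * b * w95 - (-40960000000) * b * w70 - (1) * c * w70 - (-1280000000) * c * w70 - (1) * d * w45 - (-40000000) * d * w70 - (1) * e * w20 - (-1250000) * e * w70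
  have r0 : a = 0 := by
    linear_combination ((689216734941044/597549175815625) + (-2129796583477787/2987745879078125) * p) * e0 + ((-97968759493062/23901967032625) + (7568492068308408/2987745879078125) * p) * e1 + ((19622669394890479/97958881281250) + (-48509906544178593/391835525125000) * p) * e2 + ((-42690153052250587/195917762562500) + (52767931142451857/391835525125000) * p) * e3 + ((-8009599550423354/20051985765625) + (90003722880682/364581559375) * p) * e4 - ((-36022382655077351738101909611710982199576343/597549175815625) * a + (-2300792259310932642282304213582480974974387/1195098351631250) * b + (-12698702319109102574920435722587999067/211073534375) * c + (-2246876636809624729641490447894296632093/1195098351631250) * d + (-35107407576871350156759448322143981328/597549175815625) * e) * hp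
  have r1 : b = 0 := by
    linear_combination ((-1036410379644531/54322652346875) + (6405366409957433/543226523468750) * p) * e0 + ((6163383667134418/54322652346875) + (-19045871150746646/271613261734375) * p) * e1 + ((-48189052205237893/8905352843750) + (59564944296960183/17810705687500) * p) * e2 + ((164259172880618441/26716058531250) + (-203035503608334341/53432117062500) * p) * e3 + ((5237045859892193/994313343750) + (-647334468411059/198862668750) * p) * e4 - ((86361353288548093936465576021022612939639847/108645304693750) * a + (250727361590797459647003702362892517873559/9876845881250) * b + (15222162395467731066908711151170778684/19188503125) * c + (244851940411131981959211077523051541201/9876845881250) * d + (84167650283484006693109508864232730137/108645304693750) * e) * hp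
  have r2 : c = 0 := by
    linear_combination ((19472781997592412/31449956621875) + (-120348400922378209/314499566218750) * p) * e0 + ((-21545334286820193/31449956621875) + (66578726797573313/157249783109375) * p) * e1 + ((331198287852463903/10311461187500) + (-409383597817188223/20622922375000) * p) * e2 + ((-588753523180160573/15467191781250) + (1455478753286353261/61868767125000) * p) * e3 + ((-55759135331793349/6332206031250) + (626564378515517/115131018750) * p) * e4 - ((-83590400777066983651101552717020323268665011/62899913243750) * a + (-1334754483741919930533556615231706695711856/31449956621875) * b + (-279941264601175842380770455083707519898/211073534375) * c + (-1303476485418063080962631159538084408959/31449956621875) * d + (-81466549396872685664653482571788552081/62899913243750) * e) * hp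
  have r3 : d = 0 := by
    linear_combination ((36214449179192417/54322652346875) + (-223817621205562753/543226523468750) * p) * e0 + ((-41341422466682304/54322652346875) + (127751998548549306/271613261734375) * p) * e1 + ((638184597738173901/17810705687500) + (-197209886249435369/8905352843750) * p) * e2 + ((-1953937825744331227/53432117062500) + (603799994107033003/26716058531250) * p) * e3 + ((-5237045859892193/994313343750) + (647334468411059/198862668750) * p) * e4 - ((-86361353289566243304801008401672176535388247/108645304693750) * a + (-250727361582956225934580315868898619862709/9876845881250) * b + (-15222162395467731066908711151170778684/19188503125) * c + (-244851932569898269535824583529153530351/9876845881250) * d + (-84166632134115671260728859300636981737/108645304693750) * e) * hp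
  have r4 : e = 0 := by
    linear_combination ((6580682324488686/119509835163125) + (-101677124795597322/2987745879078125) * p) * e0 + ((-34663413874828936/597549175815625) + (107115820280427943/2987745879078125) * p) * e1 + ((581051832117479073/195917762562500) + (-718219562947999703/391835525125000) * p) * e2 + ((-292248323189974351/97958881281250) + (722477587546272967/391835525125000) * p) * e3 + ((-8009599550423354/20051985765625) + (90003722880682/364581559375) * p) * e4 - ((-36022382655586426422269710731580612837068668/597549175815625) * a + (-2300792259224679071445662403883975158603787/1195098351631250) * b + (-12698702319109102574920435722587999067/211073534375) * c + (-2246876550556053892999680749388480261493/1195098351631250) * d + (-35106898502187182355639578691506489003/597549175815625) * e) * hp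
  exact ⟨r0, r1, r2, r3, r4⟩

end A5forms

section A5main

/-- The weights: total degree, and degree in `X` modulo `5`. -/
def wt5 : Fin 2 → ℤ × ZMod 5 := ![(1, 1), (1, 0)]

lemma wt5_weight (m : Fin 2 →₀ ℕ) :
    Finsupp.weight wt5 m = ((m 0 : ℤ) + (m 1 : ℤ), (m 0 : ZMod 5)) := by
  rw [Finsupp.weight_apply, Finsupp.sum_fintype _ _ (by simp), Fin.sum_univ_two]
  simp [wt5]

variable {K : Type*} [Field K]

lemma wt5_rep (J : MvPolynomial (Fin 2) K) (i : ℕ) (t : ZMod 5)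
    (h : IsWeightedHomogeneous wt5 J ((i : ℤ), t)) :
    J = ∑ j ∈ (range (i + 1)).filter (fun j : ℕ => (j : ZMod 5) = t),
      C (coeff (Finsupp.single 0 j + Finsupp.single 1 (i - j)) J) *
        X 0 ^ j * X 1 ^ (i - j) := by
  ext m
  have hmon : ∀ (c : K) (a b : ℕ), (C c * X 0 ^ a * X 1 ^ b : MvPolynomial (Fin 2) K) =
      monomial (Finsupp.single 0 a + Finsupp.single 1 b) c := by
    intro c a b
    rw [X_pow_eq_monomial, X_pow_eq_monomial, C_mul_monomial, monomial_mul]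
    simp
  simp only [hmon, coeff_sum, coeff_monomial]
  by_cases hm : coeff m J = 0
  · rw [hm, Finset.sum_eq_zero]
    intro j _
    split_ifs with hj
    · rw [hj, hm]
    · rfl
  · have hw := h hm
    rw [wt5_weight, Prod.mk.injEq] at hw
    obtain ⟨h1, h2⟩ := hw
    have h1' : m 0 + m 1 = i := by exact_mod_cast h1
    have hmm : Finsupp.single 0 (m 0) + Finsupp.single 1 (i - m 0) = m := by
      ext a
      fin_cases a
      · simp
      · simp; omega
    rw [Finset.sum_eq_single (m 0)]
    · rw [hmm, if_pos rfl]
    · intro j _ hj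
      rw [if_neg]
      intro hc
      apply hj
      rw [← hc]
      simp
    · intro hn
      exfalso
      apply hn
      rw [Finset.mem_filter, Finset.mem_range]
      exact ⟨by omega, h2⟩

lemma eval_linSub (a b c d x z : K) (f : MvPolynomial (Fin 2) K) :
    eval ![x, z] (linSub a b c d f) = eval ![a * x + b * z, c * x + d * z] f := by
  induction f using MvPolynomial.induction_on with
  | C e => simp
  | add f g hf hg => simp only [map_add, hf, hg]
  | mul_X f i hf =>
    rw [map_mul, map_mul, map_mul, hf]
    fin_cases i
    · simp [linSub_X0]
    · simp [linSub_X1]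

lemma golden_covariant_zero [CharZero K] (p : K) (hp : p ^ 2 = p + 1)
    (J : MvPolynomial (Fin 2) K) (h : ℕ) (hh : h ∈ ({2, 4, 8, 14} : Finset ℕ))
    (hJ : IsWeightedHomogeneous wt5 J (((2 * h : ℕ) : ℤ), (h : ZMod 5)))
    (hs : linSub (-p) 1 1 p J = C ((p ^ 2 + 1) ^ h) * J) : J = 0 := by
  have hr := wt5_rep J (2 * h) h hJ
  have he : ∀ x z : K, eval ![-p * x + z, x + p * z] J =
      (p ^ 2 + 1) ^ h * eval ![x, z] J := by
    intro x z
    have := congrArg (eval ![x, z]) hs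
    rw [eval_linSub] at this
    simpa using this
  simp only [Finset.mem_insert, Finset.mem_singleton] at hh
  rcases hh with rfl | rfl | rfl | rfl
  · have hfl : (range (2 * 2 + 1)).filter (fun j : ℕ => (j : ZMod 5) = ((2 : ℕ) : ZMod 5)) = {2} := by
      decide
    rw [hfl] at hr
    simp only [Finset.sum_singleton] at hr
    generalize coeff _ J = a at hr
    subst hr
    have h0 := golden_lin4 p a hp (by intro x z; simpa using he x z)
    simp [h0]
  · have hfl : (range (2 * 4 + 1)).filter (fun j : ℕ => (j : ZMod 5) = ((4 : ℕ) : ZMod 5)) = {4} := by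
      decide
    rw [hfl] at hr
    simp only [Finset.sum_singleton] at hr
    generalize coeff _ J = a at hr
    subst hr
    have h0 := golden_lin8 p a hp (by intro x z; simpa using he x z)
    simp [h0]
  · have hfl : (range (2 * 8 + 1)).filter (fun j : ℕ => (j : ZMod 5) = ((8 : ℕ) : ZMod 5)) =
        {3, 8, 13} := by
      decide
    rw [hfl, Finset.sum_insert (by decide), Finset.sum_insert (by decide),
      Finset.sum_singleton] at hr
    generalize coeff (_ + Finsupp.single 1 (2 * 8 - 3)) J = a at hr
    generalize coeff (_ + Finsupp.single 1 (2 * 8 - 8)) J = b at hr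
    generalize coeff (_ + Finsupp.single 1 (2 * 8 - 13)) J = c at hr
    subst hr
    obtain ⟨h0, h1, h2⟩ := golden_lin16 p a b c hp
      (by intro x z; simpa [add_assoc] using he x z)
    simp [h0, h1, h2]
  · have hfl : (range (2 * 14 + 1)).filter (fun j : ℕ => (j : ZMod 5) = ((14 : ℕ) : ZMod 5)) =
        {4, 9, 14, 19, 24} := by
      decide
    rw [hfl, Finset.sum_insert (by decide), Finset.sum_insert (by decide),
      Finset.sum_insert (by decide), Finset.sum_insert (by decide), Finset.sum_singleton] at hr
    generalize coeff (_ + Finsupp.single 1 (2 * 14 - 4)) J = a at hr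
    generalize coeff (_ + Finsupp.single 1 (2 * 14 - 9)) J = b at hr
    generalize coeff (_ + Finsupp.single 1 (2 * 14 - 14)) J = c at hr
    generalize coeff (_ + Finsupp.single 1 (2 * 14 - 19)) J = d at hr
    generalize coeff (_ + Finsupp.single 1 (2 * 14 - 24)) J = e at hr
    subst hr
    obtain ⟨h0, h1, h2, h3, h4⟩ := golden_lin28 p a b c d e hp
      (by intro x z; simpa [add_assoc] using he x z)
    simp [h0, h1, h2, h3, h4]

/-- The generic product of icosahedral forms of degree `60`. -/
noncomputable def a5Form {δ : ℕ} (l : Fin δ → K) : MvPolynomial (Fin 2) K :=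
  ∏ i : Fin δ, (kleinH (X 0) (X 1) ^ 3 - C (l i) * kleinF (X 0) (X 1) ^ 5)

lemma linSub_a5Form (p : K) (hp : p ^ 2 = p + 1) {δ : ℕ} (l : Fin δ → K) :
    linSub (-p) 1 1 p (a5Form l) = C ((p ^ 2 + 1) ^ (30 * δ)) * a5Form l := by
  have hP : (C p : MvPolynomial (Fin 2) K) ^ 2 = C p + 1 := by
    rw [← C_pow, hp, C_add, C_1]
  have hH : linSub (-p) 1 1 p (kleinH (X 0) (X 1)) =
      (C p ^ 2 + 1) ^ 10 * kleinH (X 0) (X 1) := by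
    rw [← kleinH_golden _ _ _ hP]
    simp [kleinH, linSub_X0, linSub_X1, map_ofNat]
  have hF : linSub (-p) 1 1 p (kleinF (X 0) (X 1)) =
      (C p ^ 2 + 1) ^ 6 * kleinF (X 0) (X 1) := by
    rw [← kleinF_golden _ _ _ hP]
    simp [kleinF, linSub_X0, linSub_X1, map_ofNat]
  unfold a5Form
  rw [map_prod]
  have hc : (C ((p ^ 2 + 1) ^ (30 * δ)) : MvPolynomial (Fin 2) K) =
      ∏ _i : Fin δ, (C p ^ 2 + 1) ^ 30 := by
    rw [Finset.prod_const, Finset.card_univ, Fintype.card_fin, ← pow_mul]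
    simp
  rw [hc, ← Finset.prod_mul_distrib]
  refine Finset.prod_congr rfl fun i _ => ?_
  rw [map_sub, map_mul, map_pow, map_pow, hH, hF, linSub_C]
  ring

lemma wt5_mono (c : K) (a b : ℕ) (s : ℤ × ZMod 5)
    (hs : s = ((a : ℤ) + (b : ℤ), (a : ZMod 5))) :
    (C c * X 0 ^ a * X 1 ^ b : MvPolynomial (Fin 2) K) ∈
      weightedHomogeneousSubmodule K wt5 s := by
  rw [mem_weightedHomogeneousSubmodule]
  have h0 := (isWeightedHomogeneous_X K wt5 (0 : Fin 2)).pow a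
  have h1 := (isWeightedHomogeneous_X K wt5 (1 : Fin 2)).pow b
  have := ((isWeightedHomogeneous_C wt5 c).mul h0).mul h1
  convert this using 1
  rw [hs]
  simp [wt5]

lemma wt5_a5Form {δ : ℕ} (l : Fin δ → K) :
    IsWeightedHomogeneous wt5 (a5Form l) ((60 * δ : ℤ), (0 : ZMod 5)) := by
  have hH : IsWeightedHomogeneous wt5 (kleinH (X 0) (X 1) : MvPolynomial (Fin 2) K)
      ((20 : ℤ), (0 : ZMod 5)) := by
    rw [← mem_weightedHomogeneousSubmodule K]
    have e : (kleinH (X 0) (X 1) : MvPolynomial (Fin 2) K) =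
        C (-1) * X 0 ^ 20 * X 1 ^ 0 + C (-1) * X 0 ^ 0 * X 1 ^ 20 + C 228 * X 0 ^ 15 * X 1 ^ 5
          + C (-228) * X 0 ^ 5 * X 1 ^ 15 + C (-494) * X 0 ^ 10 * X 1 ^ 10 := by
      simp only [kleinH, map_neg, map_ofNat, map_one]
      ring
    rw [e]
    refine add_mem (add_mem (add_mem (add_mem ?_ ?_) ?_) ?_) ?_ <;>
      exact wt5_mono _ _ _ _ (by decide)
  have hF : IsWeightedHomogeneous wt5 (kleinF (X 0) (X 1) : MvPolynomial (Fin 2) K)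
      ((12 : ℤ), (1 : ZMod 5)) := by
    rw [← mem_weightedHomogeneousSubmodule K]
    have e : (kleinF (X 0) (X 1) : MvPolynomial (Fin 2) K) =
        C 1 * X 0 ^ 11 * X 1 ^ 1 + C 11 * X 0 ^ 6 * X 1 ^ 6 + C (-1) * X 0 ^ 1 * X 1 ^ 11 := by
      simp only [kleinF, map_neg, map_ofNat, map_one]
      ring
    rw [e]
    refine add_mem (add_mem ?_ ?_) ?_ <;>
      exact wt5_mono _ _ _ _ (by decide)
  have hG : ∀ i : Fin δ, IsWeightedHomogeneous wt5
      (kleinH (X 0) (X 1) ^ 3 - C (l i) * kleinF (X 0) (X 1) ^ 5 : MvPolynomial (Fin 2) K)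
      ((60 : ℤ), (0 : ZMod 5)) := by
    intro i
    rw [← mem_weightedHomogeneousSubmodule K]
    refine sub_mem ?_ ?_
    · rw [mem_weightedHomogeneousSubmodule]
      exact hH.pow 3
    · rw [mem_weightedHomogeneousSubmodule]
      exact (hF.pow 5).C_mul _
  have := IsWeightedHomogeneous.prod Finset.univ
    (fun i : Fin δ => (kleinH (X 0) (X 1) ^ 3 - C (l i) * kleinF (X 0) (X 1) ^ 5 :
      MvPolynomial (Fin 2) K)) (fun _ => ((60 : ℤ), (0 : ZMod 5))) (fun i _ => hG i)
  unfold a5Form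
  convert this using 1
  simp [mul_comm]

lemma a5_J_zero [CharZero K] (p : K) (hp : p ^ 2 = p + 1) {δ : ℕ} (hδ : 1 ≤ δ) (l : Fin δ → K)
    (h : ℕ) (hh : h ∈ ({2, 4, 8, 14} : Finset ℕ)) :
    transvect (60 * δ) (60 * δ) (60 * δ - h) (a5Form l) (a5Form l) = 0 := by
  have hle : h ≤ 60 * δ ∧ Even h := by
    simp only [Finset.mem_insert, Finset.mem_singleton] at hh
    rcases hh with rfl | rfl | rfl | rfl <;> exact ⟨by omega, by decide⟩
  obtain ⟨hle, hev⟩ := hle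
  obtain ⟨r, hr⟩ := Nat.exists_eq_add_of_le hle
  have hrev : Even r := by
    have h60 : Even (h + r) := by rw [← hr]; exact ⟨30 * δ, by ring⟩
    exact (Nat.even_add.mp h60).mp hev
  have hsub : 60 * δ - h = r := by omega
  rw [hsub]
  refine golden_covariant_zero p hp _ h hh ?_ ?_
  · refine transvect_weighted wt5 _ _ _ _ _ _ _ _ (wt5_a5Form l) (wt5_a5Form l) ?_
    have hz : (60 * δ : ℤ) = h + r := by exact_mod_cast hr
    have h5 : (h : ZMod 5) = -(r : ZMod 5) := by
      have := congrArg (Nat.cast : ℕ → ZMod 5) hr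
      push_cast at this
      have h60 : (60 : ZMod 5) = 0 := by decide
      rw [h60, zero_mul] at this
      exact eq_neg_of_add_eq_zero_left this.symm
    ext
    · simp [wt5, hz]; ring
    · simp [wt5, h5]
  · have hD : p ^ 2 + 1 ≠ 0 := by
      intro h0
      have := golden_sq p hp
      rw [h0] at this
      have hp0 : p = 0 := by simpa using this
      rw [hp0] at hp
      norm_num at hp
    have h1 := transvect_linSub (60 * δ) (60 * δ) r (-p) 1 1 p (a5Form l) (a5Form l)
    rw [linSub_a5Form p hp, transvect_C_mul] at h1
    have e1 : (-p * p - 1 * 1) ^ r = (p ^ 2 + 1) ^ r := by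
      rw [show -p * p - 1 * 1 = -(p ^ 2 + 1) by ring, hrev.neg_pow]
    have e2 : (p ^ 2 + 1) ^ (30 * δ) * (p ^ 2 + 1) ^ (30 * δ) =
        (p ^ 2 + 1) ^ r * (p ^ 2 + 1) ^ h := by
      rw [← pow_add, ← pow_add]; congr 1; omega
    rw [e1, e2, C_mul, mul_assoc] at h1
    exact (mul_left_cancel₀ (C_ne_zero.mpr (pow_ne_zero r hD)) h1).symm

lemma map_a5Form {L : Type*} [Field L] (s : K →+* L) {δ : ℕ} (l : Fin δ → K) :
    MvPolynomial.map s (a5Form l) = a5Form (fun i => s (l i)) := by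
  simp [a5Form, kleinH, kleinF, map_prod]

end A5main

/-- Let `k` be a field of characteristic `0`, `δ ≥ 1` and
`λ₁, …, λ_δ ∈ k`.  Let `F(X,Z)` be the degree `d = 60δ` binary form
`∏_{i=1}^{δ} (−X^60 + (684−λ_i)X^55Z⁵ − ⋯ + (λ_i−684)X⁵Z^55 − Z^60)` of the generic
superelliptic curve with reduced automorphism group `A₅`.  Then for each
`i ∈ {4, 8, 16, 28}` the invariant `(J_i, J_i)^i` vanishes, where
`J_i := (F,F)^{d−i/2}` is a covariant of order `i`. -/
theorem transvectant_invariants_vanish_of_A5_form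
    (k : Type*) [Field k] [CharZero k] (δ : ℕ) (hδ : 1 ≤ δ) (l : Fin δ → k)
    (F : MvPolynomial (Fin 2) k)
    (hF : F = ∏ i : Fin δ,
      (-(X (0 : Fin 2) ^ 60)
        + (684 - C (l i)) * X (0 : Fin 2) ^ 55 * X (1 : Fin 2) ^ 5
        - (55 * C (l i) + 157434) * X (0 : Fin 2) ^ 50 * X (1 : Fin 2) ^ 10
        - (1205 * C (l i) - 12527460) * X (0 : Fin 2) ^ 45 * X (1 : Fin 2) ^ 15
        - (13090 * C (l i) + 77460495) * X (0 : Fin 2) ^ 40 * X (1 : Fin 2) ^ 20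
        + (130689144 - 69585 * C (l i)) * X (0 : Fin 2) ^ 35 * X (1 : Fin 2) ^ 25
        + (33211924 - 134761 * C (l i)) * X (0 : Fin 2) ^ 30 * X (1 : Fin 2) ^ 30
        + (69585 * C (l i) - 130689144) * X (0 : Fin 2) ^ 25 * X (1 : Fin 2) ^ 35
        - (13090 * C (l i) + 77460495) * X (0 : Fin 2) ^ 20 * X (1 : Fin 2) ^ 40
        - (12527460 - 1205 * C (l i)) * X (0 : Fin 2) ^ 15 * X (1 : Fin 2) ^ 45
        - (157434 + 55 * C (l i)) * X (0 : Fin 2) ^ 10 * X (1 : Fin 2) ^ 50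
        + (C (l i) - 684) * X (0 : Fin 2) ^ 5 * X (1 : Fin 2) ^ 55
        - X (1 : Fin 2) ^ 60))
    (d : ℕ) (hd : d = 60 * δ) :
    ∀ i ∈ ({4, 8, 16, 28} : Finset ℕ),
      transvect i i i (transvect d d (d - i / 2) F F) (transvect d d (d - i / 2) F F) = 0 := by
  have hF' : F = a5Form l := by
    rw [hF]
    unfold a5Form
    refine Finset.prod_congr rfl fun i _ => ?_
    simp only [kleinH, kleinF]
    ring
  have : CharZero (AlgebraicClosure k) :=
    charZero_of_injective_algebraMap (algebraMap k (AlgebraicClosure k)).injective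
  obtain ⟨s, hs⟩ := IsAlgClosed.exists_pow_nat_eq (5 : AlgebraicClosure k) (n := 2) (by norm_num)
  have hp : ((1 + s) / 2) ^ 2 = (1 + s) / 2 + 1 := by
    linear_combination (1 / 4) * hs
  have key : ∀ h ∈ ({2, 4, 8, 14} : Finset ℕ), transvect d d (d - h) F F = 0 := by
    intro h hh
    apply MvPolynomial.map_injective _ (algebraMap k (AlgebraicClosure k)).injective
    rw [transvect_map, hF', map_a5Form, hd, map_zero]
    exact a5_J_zero _ hp hδ _ h hh
  have hz : ∀ i : ℕ, transvect i i i (0 : MvPolynomial (Fin 2) k) 0 = 0 := by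
    intro i
    rw [transvect_eq]
    simp
  intro i hi
  have hi' : i / 2 ∈ ({2, 4, 8, 14} : Finset ℕ) := by
    simp only [Finset.mem_insert, Finset.mem_singleton] at hi ⊢
    omega
  rw [key _ hi', hz]
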